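/- Let Y be a real n×G matrix, X a real n×H matrix with XᵀX invertible, P = X(XᵀX)⁻¹Xᵀ and M = I − P. Suppose c ∈ ℝ^G satisfies cᵀ(YᵀY)c = 1 and (YᵀMY)·c = λ_min·(YᵀY)·c, and set z = Yc ∈ ℝⁿ. Then ‖Mz‖² = λ_min, ‖Pz‖² = 1 − λ_min, and the coefficient of determination of the OLS regression of z on X, namely (zᵀPz)/(zᵀz), equals 1 − λ_min. -/

import Mathlib

open Matrix

/-- The matrix `X(XᵀX)⁻¹Xᵀ` is symmetric. -/
theorem projection_transpose {m k : Type*} [Fintype m] [Fintype k] [DecidableEq k]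
    (X : Matrix m k ℝ) :
    (X * (Xᵀ * X)⁻¹ * Xᵀ)ᵀ = X * (Xᵀ * X)⁻¹ * Xᵀ := by
  simp only [transpose_mul, transpose_transpose, transpose_nonsing_inv, Matrix.mul_assoc]

/-- The matrix `X(XᵀX)⁻¹Xᵀ` is idempotent when `XᵀX` is invertible. -/
theorem projection_mul_self {m k : Type*} [Fintype m] [Fintype k] [DecidableEq k]
    (X : Matrix m k ℝ) (hX : IsUnit (Xᵀ * X)) :
    (X * (Xᵀ * X)⁻¹ * Xᵀ) * (X * (Xᵀ * X)⁻¹ * Xᵀ) = X * (Xᵀ * X)⁻¹ * Xᵀ := by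
  calc (X * (Xᵀ * X)⁻¹ * Xᵀ) * (X * (Xᵀ * X)⁻¹ * Xᵀ)
      = X * ((Xᵀ * X)⁻¹ * (Xᵀ * X)) * (Xᵀ * X)⁻¹ * Xᵀ := by simp only [Matrix.mul_assoc]
    _ = X * (Xᵀ * X)⁻¹ * Xᵀ := by
      rw [nonsing_inv_mul _ ((isUnit_iff_isUnit_det _).mp hX), Matrix.mul_one]

/-- For a symmetric idempotent `A`, the squared length of `Az` is the quadratic form `zᵀAz`. -/
theorem mulVec_dotProduct_mulVec_self {m : Type*} [Fintype m] {A : Matrix m m ℝ}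
    (hsymm : Aᵀ = A) (hidem : A * A = A) (z : m → ℝ) :
    A.mulVec z ⬝ᵥ A.mulVec z = z ⬝ᵥ A.mulVec z := by
  rw [dotProduct_mulVec, ← mulVec_transpose, hsymm, mulVec_mulVec, hidem, dotProduct_comm]

/-- The quadratic form of `YᵀAY` at `c` is that of `A` at `Yc`. -/
theorem dotProduct_transpose_mul_mul_mulVec {m k : Type*} [Fintype m] [Fintype k]
    (Y : Matrix m k ℝ) (A : Matrix m m ℝ) (c : k → ℝ) :
    c ⬝ᵥ (Yᵀ * A * Y).mulVec c = Y.mulVec c ⬝ᵥ A.mulVec (Y.mulVec c) := by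
  rw [← mulVec_mulVec, ← mulVec_mulVec, dotProduct_mulVec, vecMul_transpose]

/-- If `c` is a unit-normalized generalized eigenvector of `(YᵀMY, YᵀY)` with eigenvalue
`λ_min` and `z = Yc`, then `‖Mz‖² = λ_min`, `‖Pz‖² = 1 − λ_min`, and the coefficient of
determination `(zᵀPz)/(zᵀz)` of the OLS regression of `z` on `X` equals `1 − λ_min`. -/
theorem r_squared_eq_one_sub_lambda (n G H : ℕ)
    (Y : Matrix (Fin n) (Fin G) ℝ) (X : Matrix (Fin n) (Fin H) ℝ)
    (hX : IsUnit (Xᵀ * X))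
    (c : Fin G → ℝ) (lamMin : ℝ)
    (hnorm : c ⬝ᵥ (Yᵀ * Y).mulVec c = 1)
    (heig : ((Yᵀ * ((1 : Matrix (Fin n) (Fin n) ℝ) - X * (Xᵀ * X)⁻¹ * Xᵀ)) * Y).mulVec c
      = lamMin • (Yᵀ * Y).mulVec c) :
    let P : Matrix (Fin n) (Fin n) ℝ := X * (Xᵀ * X)⁻¹ * Xᵀ
    let M : Matrix (Fin n) (Fin n) ℝ := 1 - P
    let z : Fin n → ℝ := Y.mulVec c
    (M.mulVec z) ⬝ᵥ (M.mulVec z) = lamMin ∧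
    (P.mulVec z) ⬝ᵥ (P.mulVec z) = 1 - lamMin ∧
    (z ⬝ᵥ P.mulVec z) / (z ⬝ᵥ z) = 1 - lamMin := by
  intro P M z
  have hPt : Pᵀ = P := projection_transpose X
  have hPP : P * P = P := projection_mul_self X hX
  have hMt : Mᵀ = M := by simp only [M, transpose_sub, transpose_one, hPt]
  have hMM : M * M = M := by simp [M, mul_sub, sub_mul, hPP]
  have hzz : z ⬝ᵥ z = 1 := by
    rw [← hnorm, ← mulVec_mulVec, dotProduct_mulVec c, vecMul_transpose]
  have hzM : z ⬝ᵥ M.mulVec z = lamMin := by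
    rw [← dotProduct_transpose_mul_mul_mulVec, heig, dotProduct_smul, hnorm, smul_eq_mul, mul_one]
  have hzP : z ⬝ᵥ P.mulVec z = 1 - lamMin := by
    have h : z ⬝ᵥ M.mulVec z = z ⬝ᵥ z - z ⬝ᵥ P.mulVec z := by
      rw [sub_mulVec, one_mulVec, dotProduct_sub]
    linarith
  refine ⟨?_, ?_, ?_⟩
  · rw [mulVec_dotProduct_mulVec_self hMt hMM, hzM]
  · rw [mulVec_dotProduct_mulVec_self hPt hPP, hzP]
  · rw [hzz, div_one, hzP]
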